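/- For every ε > 0 and every δ satisfying 0 < δ < (1/L)·min(1/η, f₁(ξ₁,ε), f₂(ξ₂,ε)), the energy decays exponentially: E(t) ≤ M·E(0)·e^{−σ t} for all t > 0, where σ := δ(1 − δLη) and M := (1 + δLη)/(1 − δLη). -/

import Mathlib

/-- Partial derivative in the first (space) variable of `f = f x t`. -/
noncomputable def pdx (f : ℝ → ℝ → ℝ) (x t : ℝ) : ℝ := deriv (fun y => f y t) x

/-- Partial derivative in the second (time) variable of `f = f x t`. -/
noncomputable def pdt (f : ℝ → ℝ → ℝ) (x t : ℝ) : ℝ := deriv (fun s => f x s) t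

open Set Function MeasureTheory

lemma hasDerivAt_pdx {f : ℝ → ℝ → ℝ} (hf : Differentiable ℝ (uncurry f)) (x t : ℝ) :
    HasDerivAt (fun y => f y t) (pdx f x t) x := by
  have h : Differentiable ℝ (fun y => f y t) :=
    hf.comp (differentiable_id.prodMk (differentiable_const t))
  exact (h x).hasDerivAt

lemma hasDerivAt_pdt {f : ℝ → ℝ → ℝ} (hf : Differentiable ℝ (uncurry f)) (x t : ℝ) :
    HasDerivAt (fun s => f x s) (pdt f x t) t := by
  have h : Differentiable ℝ (fun s => f x s) :=
    hf.comp ((differentiable_const x).prodMk differentiable_id)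
  exact (h t).hasDerivAt

lemma uncurry_pdx {f : ℝ → ℝ → ℝ} (hf : Differentiable ℝ (uncurry f)) :
    uncurry (pdx f) = fun q => fderiv ℝ (uncurry f) q (1, 0) := by
  ext ⟨x, t⟩
  have h := (hf (x, t)).hasFDerivAt.comp_hasDerivAt x
    ((hasDerivAt_id x).prodMk (hasDerivAt_const x t))
  exact h.deriv

lemma uncurry_pdt {f : ℝ → ℝ → ℝ} (hf : Differentiable ℝ (uncurry f)) :
    uncurry (pdt f) = fun q => fderiv ℝ (uncurry f) q (0, 1) := by
  ext ⟨x, t⟩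
  have h := (hf (x, t)).hasFDerivAt.comp_hasDerivAt t
    ((hasDerivAt_const t x).prodMk (hasDerivAt_id t))
  exact h.deriv

lemma contDiff_pdx {f : ℝ → ℝ → ℝ} {m n : WithTop ℕ∞} (hf : ContDiff ℝ n (uncurry f))
    (hmn : m + 1 ≤ n) : ContDiff ℝ m (uncurry (pdx f)) := by
  rw [uncurry_pdx ((hf.of_le (le_add_self.trans hmn)).differentiable one_ne_zero)]
  exact (hf.fderiv_right hmn).clm_apply contDiff_const

lemma contDiff_pdt {f : ℝ → ℝ → ℝ} {m n : WithTop ℕ∞} (hf : ContDiff ℝ n (uncurry f))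
    (hmn : m + 1 ≤ n) : ContDiff ℝ m (uncurry (pdt f)) := by
  rw [uncurry_pdt ((hf.of_le (le_add_self.trans hmn)).differentiable one_ne_zero)]
  exact (hf.fderiv_right hmn).clm_apply contDiff_const

lemma pdx_pdt_comm {f : ℝ → ℝ → ℝ} (hf : ContDiff ℝ 2 (uncurry f)) (x t : ℝ) :
    pdx (pdt f) x t = pdt (pdx f) x t := by
  have hd : Differentiable ℝ (uncurry f) := hf.differentiable two_ne_zero
  have hx : ContDiff ℝ 1 (uncurry (pdx f)) := contDiff_pdx hf (by norm_num)
  have ht : ContDiff ℝ 1 (uncurry (pdt f)) := contDiff_pdt hf (by norm_num)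
  have hdd : Differentiable ℝ (fderiv ℝ (uncurry f)) :=
    (hf.fderiv_right (m := 1) (by norm_num)).differentiable one_ne_zero
  have h1 := congrFun (uncurry_pdx (ht.differentiable one_ne_zero)) (x, t)
  have h2 := congrFun (uncurry_pdt (hx.differentiable one_ne_zero)) (x, t)
  rw [uncurry_pdt hd, fderiv_clm_apply (hdd _) (differentiableAt_const _)] at h1
  rw [uncurry_pdx hd, fderiv_clm_apply (hdd _) (differentiableAt_const _)] at h2
  have hs : IsSymmSndFDerivAt ℝ (uncurry f) (x, t) :=
    hf.contDiffAt.isSymmSndFDerivAt (by simp)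
  simp only [uncurry_apply_pair] at h1 h2
  rw [h1, h2]
  simpa using hs (1, 0) (0, 1)

/-- Differentiation under the integral sign for continuous integrands with a jointly continuous
derivative in the parameter. -/
lemma hasDerivAt_intervalIntegral_of_continuous {g g' : ℝ → ℝ → ℝ} (a b : ℝ)
    (hg : Continuous (uncurry g)) (hg' : Continuous (uncurry g'))
    (hd : ∀ x t, HasDerivAt (fun s => g x s) (g' x t) t) (t : ℝ) :
    HasDerivAt (fun s => ∫ x in a..b, g x s) (∫ x in a..b, g' x t) t := by
  obtain ⟨C, hC⟩ := (isCompact_uIcc (a := a) (b := b)).prod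
    (isCompact_closedBall t 1) |>.exists_bound_of_continuousOn hg'.continuousOn
  have hcont : ∀ {h : ℝ → ℝ → ℝ}, Continuous (uncurry h) → ∀ s, Continuous fun x => h x s :=
    fun hh s => hh.comp (continuous_id.prodMk continuous_const)
  refine (intervalIntegral.hasDerivAt_integral_of_dominated_loc_of_deriv_le
    (F := fun s x => g x s) (F' := fun s x => g' x s) (bound := fun _ => C)
    (Metric.closedBall_mem_nhds t one_pos) (Filter.Eventually.of_forall fun s => ?_)
    ((hcont hg t).intervalIntegrable _ _) ?_ ?_ intervalIntegrable_const ?_).2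
  · exact (hcont hg s).aestronglyMeasurable
  · exact (hcont hg' t).aestronglyMeasurable
  · exact Filter.Eventually.of_forall fun x hx s hs =>
      hC (x, s) ⟨uIoc_subset_uIcc hx, hs⟩
  · exact Filter.Eventually.of_forall fun x _ s _ => hd x s

/-- Grönwall's inequality in the form of exponential decay. -/
lemma le_mul_exp_of_deriv_le {f f' : ℝ → ℝ} {k : ℝ} (hf : ∀ t, HasDerivAt f (f' t) t)
    (h : ∀ t > 0, f' t ≤ -k * f t) {t : ℝ} (ht : 0 ≤ t) : f t ≤ f 0 * Real.exp (-k * t) := by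
  have hd : ∀ s, HasDerivAt (fun s => f s * Real.exp (k * s))
      (f' s * Real.exp (k * s) + f s * (Real.exp (k * s) * (k * 1))) s := fun s =>
    (hf s).mul ((hasDerivAt_id s).const_mul k).exp
  have hanti : AntitoneOn (fun s => f s * Real.exp (k * s)) (Ici 0) := by
    refine antitoneOn_of_deriv_nonpos (convex_Ici 0)
      (fun s _ => (hd s).continuousAt.continuousWithinAt)
      (fun s _ => (hd s).differentiableAt.differentiableWithinAt) fun s hs => ?_
    rw [interior_Ici] at hs
    rw [(hd s).deriv]
    nlinarith [h s hs, Real.exp_pos (k * s)]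
  have h0 : f t * Real.exp (k * t) ≤ f 0 := by
    simpa using hanti self_mem_Ici ht ht
  rw [neg_mul, Real.exp_neg, ← div_eq_mul_inv]
  exact (le_div_iff₀ (Real.exp_pos _)).2 h0

lemma abs_mul_mul_le_of_sq_eq {k s A B : ℝ} (hs : 0 ≤ s) (hA : 0 ≤ A) (hB : 0 ≤ B)
    (hk : k ^ 2 = s ^ 2 * (A * B)) (x y : ℝ) :
    |k * x * y| ≤ s / 2 * (A * x ^ 2 + B * y ^ 2) := by
  refine abs_le_of_sq_le_sq ?_ (by positivity)
  have h : (k * x * y) ^ 2 = s ^ 2 * (A * B) * (x ^ 2 * y ^ 2) := by rw [← hk]; ring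
  rw [h]
  nlinarith [sq_nonneg (s * (A * x ^ 2 - B * y ^ 2))]

/-- The energy density controls the multiplier density. -/
lemma abs_multiplier_le {ρ β μ α₁ γ η : ℝ} (hρ : 0 < ρ) (hβ : 0 < β) (hμ : 0 < μ) (hα₁ : 0 < α₁)
    (hη₁ : √(ρ / α₁) + √(μ * γ ^ 2 / α₁) ≤ η) (hη₂ : √(μ / β) + √(μ * γ ^ 2 / α₁) ≤ η)
    (a b c d : ℝ) :
    |ρ * a * b + μ * c * d| ≤
      η / 2 * (ρ * a ^ 2 + μ * c ^ 2 + α₁ * b ^ 2 + β * (γ * b - d) ^ 2) := by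
  have h1 := abs_mul_mul_le_of_sq_eq (k := ρ) (Real.sqrt_nonneg (ρ / α₁)) hρ.le hα₁.le
    (by rw [Real.sq_sqrt (by positivity)]; field_simp) a b
  have h2 := abs_mul_mul_le_of_sq_eq (k := μ * γ) (Real.sqrt_nonneg (μ * γ ^ 2 / α₁)) hμ.le hα₁.le
    (by rw [Real.sq_sqrt (by positivity)]; field_simp) c b
  have h3 := abs_mul_mul_le_of_sq_eq (k := μ) (Real.sqrt_nonneg (μ / β)) hμ.le hβ.le
    (by rw [Real.sq_sqrt (by positivity)]; field_simp) c (γ * b - d)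
  have hr := Real.sqrt_nonneg (ρ / α₁)
  have hs := Real.sqrt_nonneg (μ * γ ^ 2 / α₁)
  have hq := Real.sqrt_nonneg (μ / β)
  set r := √(ρ / α₁)
  set s := √(μ * γ ^ 2 / α₁)
  set q := √(μ / β)
  have hA : 0 ≤ ρ * a ^ 2 := by positivity
  have hB : 0 ≤ α₁ * b ^ 2 := by positivity
  have hC : 0 ≤ μ * c ^ 2 := by positivity
  have hD : 0 ≤ β * (γ * b - d) ^ 2 := by positivity
  have e1 : r * (ρ * a ^ 2) ≤ η * (ρ * a ^ 2) := by gcongr; linarith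
  have e2 : (r + s) * (α₁ * b ^ 2) ≤ η * (α₁ * b ^ 2) := by gcongr
  have e3 : (q + s) * (μ * c ^ 2) ≤ η * (μ * c ^ 2) := by gcongr
  have e4 : q * (β * (γ * b - d) ^ 2) ≤ η * (β * (γ * b - d) ^ 2) := by gcongr; linarith
  rw [abs_le] at *
  constructor <;> nlinarith

/-- The boundary feedback dominates the boundary term produced by the multiplier. -/
lemma boundary_dissipation {ρ β μ α₁ γ L α ξ₁ ξ₂ ε δ : ℝ} (hρ : 0 < ρ) (hβ : 0 < β) (hμ : 0 < μ)
    (hα₁ : 0 < α₁) (hα : α = α₁ + γ ^ 2 * β) (hε : 0 < ε)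
    (h1 : δ * L ≤ 2 * ξ₁ * α₁ / (ρ * α₁ + (1 + ε) * ξ₁ ^ 2))
    (h2 : δ * L ≤ 2 * ξ₂ * ε * α₁ * β / (ε * μ * α₁ * β + (ε * α + γ ^ 2 * β) * ξ₂ ^ 2))
    (hδL : 0 ≤ δ * L) {a b c d : ℝ}
    (hb1 : α * b - γ * β * d = -ξ₁ * a) (hb2 : -(γ * β) * b + β * d = -ξ₂ * c) :
    a * (α * b - γ * β * d) + c * (-(γ * β) * b + β * d)
      + δ * L * (1 / 2 * (ρ * a ^ 2 + μ * c ^ 2 + α₁ * b ^ 2 + β * (γ * b - d) ^ 2)) ≤ 0 := by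
  have hα_pos : 0 < α := by rw [hα]; positivity
  rw [le_div_iff₀ (by positivity)] at h1 h2
  rw [hb1, hb2]
  have hw : γ * b - d = ξ₂ * c / β := by field_simp; linarith
  have hb : b = -(ξ₁ * a + γ * ξ₂ * c) / α₁ := by
    field_simp
    subst hα
    linear_combination hb1 + γ * hb2
  have young : (ξ₁ * a + γ * ξ₂ * c) ^ 2 ≤
      (1 + ε) * (ξ₁ * a) ^ 2 + (1 + 1 / ε) * (γ * ξ₂ * c) ^ 2 := by
    have : (1 + ε) * (ξ₁ * a) ^ 2 + (1 + 1 / ε) * (γ * ξ₂ * c) ^ 2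
        - (ξ₁ * a + γ * ξ₂ * c) ^ 2 = (ε * (ξ₁ * a) - γ * ξ₂ * c) ^ 2 / ε := by
      field_simp; ring
    have : 0 ≤ (ε * (ξ₁ * a) - γ * ξ₂ * c) ^ 2 / ε := by positivity
    linarith
  have hbsq : α₁ * b ^ 2 ≤
      ((1 + ε) * (ξ₁ * a) ^ 2 + (1 + 1 / ε) * (γ * ξ₂ * c) ^ 2) / α₁ := by
    have : α₁ * b ^ 2 = (ξ₁ * a + γ * ξ₂ * c) ^ 2 / α₁ := by rw [hb]; field_simp
    rw [this]; gcongr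
  have ha : δ * L * (ρ + (1 + ε) * ξ₁ ^ 2 / α₁) ≤ 2 * ξ₁ := by
    have : δ * L * (ρ + (1 + ε) * ξ₁ ^ 2 / α₁)
        = δ * L * (ρ * α₁ + (1 + ε) * ξ₁ ^ 2) / α₁ := by field_simp
    rw [this, div_le_iff₀ hα₁]; exact h1
  have hc : δ * L * (μ + (1 + 1 / ε) * (γ * ξ₂) ^ 2 / α₁ + ξ₂ ^ 2 / β) ≤ 2 * ξ₂ := by
    have : δ * L * (μ + (1 + 1 / ε) * (γ * ξ₂) ^ 2 / α₁ + ξ₂ ^ 2 / β)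
        = δ * L * (ε * μ * α₁ * β + (ε * α + γ ^ 2 * β) * ξ₂ ^ 2) / (ε * α₁ * β) := by
      subst hα; field_simp; ring
    rw [this, div_le_iff₀ (by positivity)]; linarith
  have hsum : ρ * a ^ 2 + μ * c ^ 2 + α₁ * b ^ 2 + β * (γ * b - d) ^ 2 ≤
      (ρ + (1 + ε) * ξ₁ ^ 2 / α₁) * a ^ 2
        + (μ + (1 + 1 / ε) * (γ * ξ₂) ^ 2 / α₁ + ξ₂ ^ 2 / β) * c ^ 2 := by
    have : β * (γ * b - d) ^ 2 = ξ₂ ^ 2 / β * c ^ 2 := by rw [hw]; field_simp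
    rw [this]
    refine le_of_le_of_eq (add_le_add_left (add_le_add_right hbsq _) _) ?_
    ring
  have := mul_le_mul_of_nonneg_left hsum hδL
  nlinarith [mul_le_mul_of_nonneg_right ha (sq_nonneg a),
    mul_le_mul_of_nonneg_right hc (sq_nonneg c)]

/-- Twice the energy density of the beam. -/
noncomputable def energyDensity (ρ β μ α₁ γ : ℝ) (v p : ℝ → ℝ → ℝ) (x t : ℝ) : ℝ :=
  ρ * (pdt v x t) ^ 2 + μ * (pdt p x t) ^ 2 + α₁ * (pdx v x t) ^ 2
    + β * (γ * pdx v x t - pdx p x t) ^ 2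

/-- Density of the Lyapunov functional: the energy density perturbed by the multiplier term. -/
noncomputable def lyapunovDensity (ρ β μ α₁ γ δ : ℝ) (v p : ℝ → ℝ → ℝ) (x t : ℝ) : ℝ :=
  1 / 2 * energyDensity ρ β μ α₁ γ v p x t
    + δ * x * (ρ * pdt v x t * pdx v x t + μ * pdt p x t * pdx p x t)

/-- The flux of the Lyapunov density. -/
noncomputable def lyapunovFlux (ρ β μ α₁ γ δ : ℝ) (v p : ℝ → ℝ → ℝ) (x t : ℝ) : ℝ :=
  pdt v x t * ((α₁ + γ ^ 2 * β) * pdx v x t - γ * β * pdx p x t)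
    + pdt p x t * (-(γ * β) * pdx v x t + β * pdx p x t)
    + δ * x * (1 / 2 * energyDensity ρ β μ α₁ γ v p x t)

section Densities

variable {ρ β μ α₁ γ δ : ℝ} {v p : ℝ → ℝ → ℝ}

lemma contDiff_energyDensity (hv : ContDiff ℝ 2 (uncurry v)) (hp : ContDiff ℝ 2 (uncurry p)) :
    ContDiff ℝ 1 (uncurry (energyDensity ρ β μ α₁ γ v p)) := by
  have ha : ContDiff ℝ 1 fun q : ℝ × ℝ => pdt v q.1 q.2 := contDiff_pdt hv (by norm_num)
  have hb : ContDiff ℝ 1 fun q : ℝ × ℝ => pdx v q.1 q.2 := contDiff_pdx hv (by norm_num)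
  have hc : ContDiff ℝ 1 fun q : ℝ × ℝ => pdt p q.1 q.2 := contDiff_pdt hp (by norm_num)
  have hd : ContDiff ℝ 1 fun q : ℝ × ℝ => pdx p q.1 q.2 := contDiff_pdx hp (by norm_num)
  unfold uncurry energyDensity
  fun_prop

lemma contDiff_lyapunovDensity (hv : ContDiff ℝ 2 (uncurry v)) (hp : ContDiff ℝ 2 (uncurry p)) :
    ContDiff ℝ 1 (uncurry (lyapunovDensity ρ β μ α₁ γ δ v p)) := by
  have ha : ContDiff ℝ 1 fun q : ℝ × ℝ => pdt v q.1 q.2 := contDiff_pdt hv (by norm_num)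
  have hb : ContDiff ℝ 1 fun q : ℝ × ℝ => pdx v q.1 q.2 := contDiff_pdx hv (by norm_num)
  have hc : ContDiff ℝ 1 fun q : ℝ × ℝ => pdt p q.1 q.2 := contDiff_pdt hp (by norm_num)
  have hd : ContDiff ℝ 1 fun q : ℝ × ℝ => pdx p q.1 q.2 := contDiff_pdx hp (by norm_num)
  have he : ContDiff ℝ 1 fun q : ℝ × ℝ => energyDensity ρ β μ α₁ γ v p q.1 q.2 :=
    contDiff_energyDensity hv hp
  unfold uncurry lyapunovDensity
  fun_prop

lemma contDiff_lyapunovFlux (hv : ContDiff ℝ 2 (uncurry v)) (hp : ContDiff ℝ 2 (uncurry p)) :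
    ContDiff ℝ 1 (uncurry (lyapunovFlux ρ β μ α₁ γ δ v p)) := by
  have ha : ContDiff ℝ 1 fun q : ℝ × ℝ => pdt v q.1 q.2 := contDiff_pdt hv (by norm_num)
  have hb : ContDiff ℝ 1 fun q : ℝ × ℝ => pdx v q.1 q.2 := contDiff_pdx hv (by norm_num)
  have hc : ContDiff ℝ 1 fun q : ℝ × ℝ => pdt p q.1 q.2 := contDiff_pdt hp (by norm_num)
  have hd : ContDiff ℝ 1 fun q : ℝ × ℝ => pdx p q.1 q.2 := contDiff_pdx hp (by norm_num)
  have he : ContDiff ℝ 1 fun q : ℝ × ℝ => energyDensity ρ β μ α₁ γ v p q.1 q.2 :=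
    contDiff_energyDensity hv hp
  unfold uncurry lyapunovFlux
  fun_prop

/-- The local balance law satisfied by the Lyapunov density along solutions of the beam
equations. -/
lemma pdx_lyapunovFlux (hv : ContDiff ℝ 2 (uncurry v)) (hp : ContDiff ℝ 2 (uncurry p)) {x t : ℝ}
    (heq1 : ρ * pdt (pdt v) x t = (α₁ + γ ^ 2 * β) * pdx (pdx v) x t - γ * β * pdx (pdx p) x t)
    (heq2 : μ * pdt (pdt p) x t = -(γ * β) * pdx (pdx v) x t + β * pdx (pdx p) x t) :
    pdx (lyapunovFlux ρ β μ α₁ γ δ v p) x t =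
      pdt (lyapunovDensity ρ β μ α₁ γ δ v p) x t
        + δ * (1 / 2 * energyDensity ρ β μ α₁ γ v p x t) := by
  have ha := (contDiff_pdt (m := 1) hv (by norm_num)).differentiable one_ne_zero
  have hb := (contDiff_pdx (m := 1) hv (by norm_num)).differentiable one_ne_zero
  have hc := (contDiff_pdt (m := 1) hp (by norm_num)).differentiable one_ne_zero
  have hd := (contDiff_pdx (m := 1) hp (by norm_num)).differentiable one_ne_zero
  have ax := hasDerivAt_pdx ha x t
  have bx := hasDerivAt_pdx hb x t
  have cx := hasDerivAt_pdx hc x t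
  have dx := hasDerivAt_pdx hd x t
  have atd := hasDerivAt_pdt ha x t
  have bt := hasDerivAt_pdt hb x t
  have ct := hasDerivAt_pdt hc x t
  have dt := hasDerivAt_pdt hd x t
  rw [pdx_pdt_comm hv] at ax
  rw [pdx_pdt_comm hp] at cx
  have ex := ((((ax.pow 2).const_mul ρ).add ((cx.pow 2).const_mul μ)).add
    ((bx.pow 2).const_mul α₁)).add ((((bx.const_mul γ).sub dx).pow 2).const_mul β)
  have et := ((((atd.pow 2).const_mul ρ).add ((ct.pow 2).const_mul μ)).add
    ((bt.pow 2).const_mul α₁)).add ((((bt.const_mul γ).sub dt).pow 2).const_mul β)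
  have hx := ((ax.mul ((bx.const_mul (α₁ + γ ^ 2 * β)).sub (dx.const_mul (γ * β)))).add
    (cx.mul ((bx.const_mul (-(γ * β))).add (dx.const_mul β)))).add
    (((hasDerivAt_id x).const_mul δ).mul (ex.const_mul (1 / 2)))
  have ht := (et.const_mul (1 / 2)).add
    ((((atd.const_mul ρ).mul bt).add ((ct.const_mul μ).mul dt)).const_mul (δ * x))
  refine hx.deriv.trans ?_
  rw [show pdt (lyapunovDensity ρ β μ α₁ γ δ v p) x t = _ from ht.deriv]
  simp only [energyDensity, Pi.add_apply, Pi.sub_apply, Pi.pow_apply, id]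
  push_cast
  linear_combination -(pdt v x t + δ * x * pdx v x t) * heq1
    - (pdt p x t + δ * x * pdx p x t) * heq2

/-- The energy identity of the Lyapunov functional. -/
lemma integral_pdt_lyapunovDensity {L t : ℝ} (hL : 0 ≤ L)
    (hv : ContDiff ℝ 2 (uncurry v)) (hp : ContDiff ℝ 2 (uncurry p))
    (heq1 : ∀ x ∈ Ioo 0 L,
      ρ * pdt (pdt v) x t = (α₁ + γ ^ 2 * β) * pdx (pdx v) x t - γ * β * pdx (pdx p) x t)
    (heq2 : ∀ x ∈ Ioo 0 L,
      μ * pdt (pdt p) x t = -(γ * β) * pdx (pdx v) x t + β * pdx (pdx p) x t) :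
    ∫ x in (0 : ℝ)..L, pdt (lyapunovDensity ρ β μ α₁ γ δ v p) x t =
      lyapunovFlux ρ β μ α₁ γ δ v p L t - lyapunovFlux ρ β μ α₁ γ δ v p 0 t
        - δ * (1 / 2 * ∫ x in (0 : ℝ)..L, energyDensity ρ β μ α₁ γ v p x t) := by
  have hline : ∀ {g : ℝ → ℝ → ℝ}, Continuous (uncurry g) → Continuous fun x => g x t :=
    fun hg => hg.comp (continuous_id.prodMk continuous_const)
  have hflux : ContDiff ℝ 1 (uncurry (lyapunovFlux ρ β μ α₁ γ δ v p)) :=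
    contDiff_lyapunovFlux hv hp
  have hG : Continuous fun x => pdt (lyapunovDensity ρ β μ α₁ γ δ v p) x t :=
    hline (contDiff_pdt (m := 0) (contDiff_lyapunovDensity hv hp) (by norm_num)).continuous
  have he : Continuous fun x => energyDensity ρ β μ α₁ γ v p x t :=
    hline (contDiff_energyDensity hv hp).continuous
  have hFTC := intervalIntegral.integral_eq_sub_of_hasDerivAt_of_le hL
    (hline hflux.continuous).continuousOn
    (f' := fun x => pdt (lyapunovDensity ρ β μ α₁ γ δ v p) x t
        + δ * (1 / 2 * energyDensity ρ β μ α₁ γ v p x t))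
    (fun x hx => by
      rw [← pdx_lyapunovFlux hv hp (heq1 x hx) (heq2 x hx)]
      exact hasDerivAt_pdx (hflux.differentiable one_ne_zero) x t)
    ((hG.add (by fun_prop)).intervalIntegrable _ _)
  rw [intervalIntegral.integral_add (hG.intervalIntegrable _ _)
    (Continuous.intervalIntegrable (by fun_prop) _ _),
    intervalIntegral.integral_const_mul, intervalIntegral.integral_const_mul] at hFTC
  linarith

/-- The Lyapunov functional is equivalent to the energy. -/
lemma abs_integral_lyapunovDensity_sub_le {L η : ℝ} (hρ : 0 < ρ) (hβ : 0 < β) (hμ : 0 < μ)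
    (hα₁ : 0 < α₁) (hL : 0 ≤ L) (hδ : 0 ≤ δ)
    (hη₁ : √(ρ / α₁) + √(μ * γ ^ 2 / α₁) ≤ η) (hη₂ : √(μ / β) + √(μ * γ ^ 2 / α₁) ≤ η)
    (hv : ContDiff ℝ 2 (uncurry v)) (hp : ContDiff ℝ 2 (uncurry p)) (t : ℝ) :
    |(∫ x in (0 : ℝ)..L, lyapunovDensity ρ β μ α₁ γ δ v p x t)
        - 1 / 2 * ∫ x in (0 : ℝ)..L, energyDensity ρ β μ α₁ γ v p x t| ≤
      δ * L * η * (1 / 2 * ∫ x in (0 : ℝ)..L, energyDensity ρ β μ α₁ γ v p x t) := by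
  have hline : ∀ {g : ℝ → ℝ → ℝ}, ContDiff ℝ 1 (uncurry g) → Continuous fun x => g x t :=
    fun hg => hg.continuous.comp (continuous_id.prodMk continuous_const)
  have he : Continuous fun x => energyDensity ρ β μ α₁ γ v p x t :=
    hline (contDiff_energyDensity hv hp)
  have hG : Continuous fun x => lyapunovDensity ρ β μ α₁ γ δ v p x t :=
    hline (contDiff_lyapunovDensity hv hp)
  rw [← intervalIntegral.integral_const_mul, ← intervalIntegral.integral_const_mul,
    ← intervalIntegral.integral_sub (hG.intervalIntegrable _ _)
      (Continuous.intervalIntegrable (by fun_prop) _ _), ← Real.norm_eq_abs]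
  refine intervalIntegral.norm_integral_le_of_norm_le hL (ae_of_all _ fun x hx => ?_)
    (Continuous.intervalIntegrable (by fun_prop) _ _)
  have hm := abs_multiplier_le hρ hβ hμ hα₁ hη₁ hη₂
    (pdt v x t) (pdx v x t) (pdt p x t) (pdx p x t)
  rw [lyapunovDensity, add_sub_cancel_left, Real.norm_eq_abs, abs_mul,
    abs_of_nonneg (mul_nonneg hδ hx.1.le)]
  calc _ ≤ δ * L * |ρ * pdt v x t * pdx v x t + μ * pdt p x t * pdx p x t| := by
        gcongr; exact hx.2
    _ ≤ δ * L * (η / 2 * energyDensity ρ β μ α₁ γ v p x t) := by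
        gcongr; exact hm
    _ = _ := by ring

end Densities

lemma pdt_eq_zero_of_forall_pos {f : ℝ → ℝ → ℝ} {x t : ℝ} (h : ∀ s > 0, f x s = 0) (ht : 0 < t) :
    pdt f x t = 0 := by
  have : (fun s => f x s) =ᶠ[nhds t] fun _ => 0 :=
    Filter.eventually_of_mem (Ioi_mem_nhds ht) h
  rw [pdt, this.deriv_eq, deriv_const]

/-- For every `ε > 0` and `0 < δ < (1/L) min(1/η, f₁(ξ₁,ε), f₂(ξ₂,ε))`,
the energy decays exponentially: `E(t) ≤ M E(0) e^{−σ t}` with `σ = δ(1 − δLη)` and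
`M = (1 + δLη)/(1 − δLη)`. -/
theorem energy_exponential_decay
    (ρ β μ α₁ L γ : ℝ) (hρ : 0 < ρ) (hβ : 0 < β) (hμ : 0 < μ) (hα₁ : 0 < α₁) (hL : 0 < L)
    (α : ℝ) (hα : α = α₁ + γ ^ 2 * β)
    (η : ℝ)
    (hη : η = max (Real.sqrt (ρ / α₁) + Real.sqrt (μ * γ ^ 2 / α₁))
                  (Real.sqrt (μ / β) + Real.sqrt (μ * γ ^ 2 / α₁)))
    (ξ₁ ξ₂ : ℝ) (hξ₁ : 0 < ξ₁) (hξ₂ : 0 < ξ₂)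
    (v p : ℝ → ℝ → ℝ)
    (hv : ContDiff ℝ 2 (Function.uncurry v)) (hp : ContDiff ℝ 2 (Function.uncurry p))
    (heq1 : ∀ x ∈ Set.Ioo (0:ℝ) L, ∀ t > (0:ℝ),
      ρ * pdt (pdt v) x t = α * pdx (pdx v) x t - γ * β * pdx (pdx p) x t)
    (heq2 : ∀ x ∈ Set.Ioo (0:ℝ) L, ∀ t > (0:ℝ),
      μ * pdt (pdt p) x t = -(γ * β) * pdx (pdx v) x t + β * pdx (pdx p) x t)
    (hbc0 : ∀ t > (0:ℝ), v 0 t = 0 ∧ p 0 t = 0)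
    (hbc1 : ∀ t > (0:ℝ), α * pdx v L t - γ * β * pdx p L t = -ξ₁ * pdt v L t)
    (hbc2 : ∀ t > (0:ℝ), -(γ * β) * pdx v L t + β * pdx p L t = -ξ₂ * pdt p L t)
    (E : ℝ → ℝ)
    (hE : ∀ t, E t = (1 / 2) * ∫ x in (0:ℝ)..L,
        ρ * (pdt v x t) ^ 2 + μ * (pdt p x t) ^ 2 + α₁ * (pdx v x t) ^ 2
          + β * (γ * pdx v x t - pdx p x t) ^ 2)
    : ∀ ε > (0:ℝ), ∀ δ : ℝ, 0 < δ →
      δ < (1 / L) * min (min (1 / η) (2 * ξ₁ * α₁ / (ρ * α₁ + (1 + ε) * ξ₁ ^ 2)))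
            (2 * ξ₂ * ε * α₁ * β / (ε * μ * α₁ * β + (ε * α + γ ^ 2 * β) * ξ₂ ^ 2)) →
      ∀ t > (0:ℝ),
        E t ≤ ((1 + δ * L * η) / (1 - δ * L * η)) * E 0 *
          Real.exp (-(δ * (1 - δ * L * η)) * t) := by
  subst hα
  intro ε hε δ hδ hδ_lt t ht
  have hη₁ : √(ρ / α₁) + √(μ * γ ^ 2 / α₁) ≤ η := hη ▸ le_max_left _ _
  have hη₂ : √(μ / β) + √(μ * γ ^ 2 / α₁) ≤ η := hη ▸ le_max_right _ _
  have hη_pos : 0 < η := lt_of_lt_of_le (by positivity) hη₁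
  rw [one_div, inv_mul_eq_div, lt_div_iff₀ hL, lt_min_iff, lt_min_iff] at hδ_lt
  obtain ⟨⟨hδη, h1⟩, h2⟩ := hδ_lt
  rw [lt_div_iff₀ hη_pos] at hδη
  set Λ : ℝ → ℝ := fun s => ∫ x in (0 : ℝ)..L, lyapunovDensity ρ β μ α₁ γ δ v p x s
  have hequiv : ∀ s, |Λ s - E s| ≤ δ * L * η * E s := fun s => by
    rw [hE]
    exact abs_integral_lyapunovDensity_sub_le hρ hβ hμ hα₁ hL.le hδ.le hη₁ hη₂ hv hp s
  have hE_nonneg : ∀ s, 0 ≤ E s := fun s =>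
    nonneg_of_mul_nonneg_right ((abs_nonneg _).trans (hequiv s)) (by positivity)
  have hG : ContDiff ℝ 1 (uncurry (lyapunovDensity ρ β μ α₁ γ δ v p)) :=
    contDiff_lyapunovDensity hv hp
  have hΛ : ∀ s, HasDerivAt Λ
      (∫ x in (0 : ℝ)..L, pdt (lyapunovDensity ρ β μ α₁ γ δ v p) x s) s :=
    hasDerivAt_intervalIntegral_of_continuous 0 L hG.continuous
      (contDiff_pdt (m := 0) hG (by norm_num)).continuous
      (hasDerivAt_pdt (hG.differentiable one_ne_zero))
  have hdecay := le_mul_exp_of_deriv_le (k := δ * (1 - δ * L * η)) hΛ (fun s hs => by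
    rw [integral_pdt_lyapunovDensity hL.le hv hp (fun x hx => heq1 x hx s hs)
      (fun x hx => heq2 x hx s hs)]
    have hflux0 : lyapunovFlux ρ β μ α₁ γ δ v p 0 s = 0 := by
      simp [lyapunovFlux, pdt_eq_zero_of_forall_pos (fun r hr => (hbc0 r hr).1) hs,
        pdt_eq_zero_of_forall_pos (fun r hr => (hbc0 r hr).2) hs]
    have hfluxL : lyapunovFlux ρ β μ α₁ γ δ v p L s ≤ 0 :=
      boundary_dissipation hρ hβ hμ hα₁ rfl hε h1.le h2.le (by positivity)
        (hbc1 s hs) (hbc2 s hs)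
    have hEs : 1 / 2 * ∫ x in (0 : ℝ)..L, energyDensity ρ β μ α₁ γ v p x s = E s := (hE s).symm
    rw [hflux0, hEs]
    have hΛE : Λ s ≤ (1 + δ * L * η) * E s := by linarith [(abs_le.1 (hequiv s)).2]
    have : (1 - δ * L * η) * Λ s ≤ (1 - δ * L * η) * ((1 + δ * L * η) * E s) :=
      mul_le_mul_of_nonneg_left hΛE (by linarith)
    have : (1 - δ * L * η) * Λ s ≤ E s := by
      nlinarith [mul_nonneg (sq_nonneg (δ * L * η)) (hE_nonneg s)]
    nlinarith) ht.le
  have hlower : (1 - δ * L * η) * E t ≤ Λ t := by linarith [(abs_le.1 (hequiv t)).1]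
  have hupper : Λ 0 ≤ (1 + δ * L * η) * E 0 := by linarith [(abs_le.1 (hequiv 0)).2]
  have hexp := Real.exp_pos (-(δ * (1 - δ * L * η)) * t)
  rw [div_mul_eq_mul_div, div_mul_eq_mul_div, le_div_iff₀ (by linarith), mul_comm (E t)]
  exact hlower.trans (hdecay.trans (mul_le_mul_of_nonneg_right hupper hexp.le))
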